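/- Let d be an admissible sequence and k₁ ∈ ℂ. Then for every real s > 0 the series G(s) = Σ_{m≥0} Σ_{n≥l₁} c^{2n+m} q^{(1+2s)n + (s-1/2)m} d_m k₁ · Σ_{l=l₁}^{n} ((c^{-1}α^{-1} q^{1/2-2s})^l - (c^{-1}α^{-1} q^{1/2})^l) converges absolutely, and lim_{s→0⁺} s·G(s) = 0. -/

import Mathlib

open Filter Topology

noncomputable section

/-- `qc q x` is the real power `q ^ x`, viewed as a complex number. -/
def qc (q : ℝ) (x : ℝ) : ℂ := ((q ^ x : ℝ) : ℂ)

/-- An admissible sequence: `d m = q^(m/2) (c₁ c^m + c₂ c^(-m))` for all `m ≥ l₁`. -/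
def IsAdmissibleSeq (q : ℝ) (c : ℂ) (l₁ : ℤ) (d : ℕ → ℂ) : Prop :=
  ∃ c₁ c₂ : ℂ, ∀ m : ℕ, l₁ ≤ (m : ℤ) →
    d m = qc q ((m : ℝ) / 2) * (c₁ * c ^ (m : ℤ) + c₂ * c ^ (-(m : ℤ)))

/-- An admissible family on `ℤ × ℕ`, given by region asymptotics. -/
def IsAdmissibleFam (q : ℝ) (l₁ : ℤ) (a : ℤ → ℕ → ℂ) : Prop :=
  ∃ (k₁ k₂ k₃ : ℂ) (A B : ℤ → ℂ), ∀ (n : ℤ) (m : ℕ),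
    (l₁ ≤ n → a n m = k₁) ∧
    (-l₁ < n → n < l₁ → l₁ ≤ n + (m : ℤ) → a n m = A n) ∧
    (n ≤ -l₁ → l₁ ≤ n + (m : ℤ) → a n m = qc q (-(n : ℝ)) * k₂) ∧
    (n ≤ -l₁ → -l₁ < n + (m : ℤ) → n + (m : ℤ) < l₁ →
      a n m = qc q (-(n : ℝ)) * B (n + m)) ∧
    (n + (m : ℤ) ≤ -l₁ → a n m = qc q (-(2 * (n : ℝ) + (m : ℝ))) * k₃)

/-- An `l`-stabilized family on `ℤ × ℕ` (the regions do not depend on `l`). -/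
def IsStabilizedFam (q : ℝ) (c : ℂ) (l₁ : ℤ) (e : ℤ → ℕ → ℂ) : Prop :=
  ∃ (u w : ℂ) (f v : ℤ → ℂ) (N : ℤ), 2 * l₁ < N ∧ ∀ (n : ℤ) (m : ℕ),
    (l₁ ≤ n → e n m = (c ^ 2 * (q : ℂ)) ^ n * (c * qc q (1 / 2)) ^ m * u) ∧
    (-l₁ < n → n < l₁ → N ≤ (m : ℤ) → e n m = (c * qc q (1 / 2)) ^ m * f n) ∧
    (n ≤ -l₁ → -l₁ < n + (m : ℤ) → n + (m : ℤ) < l₁ → N ≤ (m : ℤ) →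
      e n m = qc q ((m : ℝ) / 2) * c ^ (-(m : ℤ)) * v (n + m)) ∧
    (n + (m : ℤ) ≤ -l₁ → e n m = (c ^ 2 * (q : ℂ)⁻¹) ^ n * (c * qc q (-(1 / 2))) ^ m * w)

lemma norm_qc {q : ℝ} (hq0 : 0 < q) (x : ℝ) : ‖qc q x‖ = q ^ x := by
  rw [qc, Complex.norm_real, Real.norm_of_nonneg (Real.rpow_nonneg hq0.le x)]

lemma qc_zpow {q : ℝ} (hq0 : 0 < q) (x : ℝ) (l : ℤ) : qc q x ^ l = qc q (x * l) := by
  rw [qc, qc, Real.rpow_mul hq0.le, Real.rpow_intCast, Complex.ofReal_zpow]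

lemma IsAdmissibleSeq.exists_norm_le {q : ℝ} (hq0 : 0 < q) {c : ℂ} (hc : ‖c‖ = 1) {l₁ : ℤ}
    {d : ℕ → ℂ} (hd : IsAdmissibleSeq q c l₁ d) :
    ∃ C : ℝ, 0 ≤ C ∧ ∀ m : ℕ, ‖d m‖ ≤ C * q ^ ((m : ℝ) / 2) := by
  obtain ⟨c₁, c₂, h⟩ := hd
  have hpos : ∀ m : ℕ, 0 < q ^ ((m : ℝ) / 2) := fun m => Real.rpow_pos_of_pos hq0 _
  have hnonneg : ∀ m : ℕ, 0 ≤ ‖d m‖ / q ^ ((m : ℝ) / 2) := fun m =>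
    div_nonneg (norm_nonneg _) (hpos m).le
  have hsum : 0 ≤ ∑ m ∈ Finset.range l₁.toNat, ‖d m‖ / q ^ ((m : ℝ) / 2) :=
    Finset.sum_nonneg fun m _ => hnonneg m
  refine ⟨‖c₁‖ + ‖c₂‖ + ∑ m ∈ Finset.range l₁.toNat, ‖d m‖ / q ^ ((m : ℝ) / 2),
    by positivity, fun m => ?_⟩
  rw [← div_le_iff₀ (hpos m)]
  by_cases hm : l₁ ≤ (m : ℤ)
  · have hb : ‖c₁ * c ^ (m : ℤ) + c₂ * c ^ (-(m : ℤ))‖ ≤ ‖c₁‖ + ‖c₂‖ := by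
      refine (norm_add_le _ _).trans ?_
      simp [hc]
    rw [h m hm, norm_mul, norm_qc hq0, mul_div_cancel_left₀ _ (hpos m).ne']
    linarith
  · have hle := Finset.single_le_sum (f := fun m : ℕ => ‖d m‖ / q ^ ((m : ℝ) / 2))
      (fun m _ => hnonneg m) (Finset.mem_range.2 (show m < l₁.toNat by lia))
    have h₁ := norm_nonneg c₁
    have h₂ := norm_nonneg c₂
    linarith

lemma rpow_mul_norm_zpow_sub_zpow_le {q : ℝ} (hq0 : 0 < q) (hq1 : q < 1) {β : ℂ} (hβ : ‖β‖ = 1)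
    {s : ℝ} (hs : 0 < s) {l n : ℤ} (hl : 0 < l) (hln : l ≤ n) :
    q ^ ((1 + 2 * s) * (n : ℝ)) * ‖(β * qc q (1 / 2 - 2 * s)) ^ l - (β * qc q (1 / 2)) ^ l‖ ≤
      q ^ (n : ℝ) * (2 * s * n * -Real.log q) := by
  have hl' : (0 : ℝ) < l := by exact_mod_cast hl
  have hln' : (l : ℝ) ≤ n := by exact_mod_cast hln
  have hlog : 0 < -Real.log q := neg_pos.2 (Real.log_neg hq0 hq1)
  have hle : q ^ (2 * s * l) ≤ 1 := Real.rpow_le_one hq0.le hq1.le (by positivity)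
  have hfac : q ^ (1 / 2 * (l : ℝ)) =
      q ^ ((1 / 2 - 2 * s) * (l : ℝ)) * q ^ (2 * s * l) := by
    rw [← Real.rpow_add hq0]; ring_nf
  have hnorm : ‖(β * qc q (1 / 2 - 2 * s)) ^ l - (β * qc q (1 / 2)) ^ l‖ =
      q ^ ((1 / 2 - 2 * s) * (l : ℝ)) * (1 - q ^ (2 * s * l)) := by
    rw [mul_zpow, mul_zpow, ← mul_sub, norm_mul, norm_zpow, hβ, one_zpow, one_mul,
      qc_zpow hq0, qc_zpow hq0, qc, qc, ← Complex.ofReal_sub, Complex.norm_real, hfac,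
      ← mul_one_sub, Real.norm_of_nonneg]
    exact mul_nonneg (Real.rpow_nonneg hq0.le _) (sub_nonneg.2 hle)
  rw [hnorm, ← mul_assoc, ← Real.rpow_add hq0]
  refine mul_le_mul ?_ ?_ (sub_nonneg.2 hle) (Real.rpow_nonneg hq0.le _)
  · refine Real.rpow_le_rpow_of_exponent_ge hq0 hq1.le ?_
    nlinarith
  · have hexp := Real.add_one_le_exp (Real.log q * (2 * s * l))
    rw [← Real.rpow_def_of_pos hq0] at hexp
    have hmono : 2 * s * l * -Real.log q ≤ 2 * s * n * -Real.log q := by gcongr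
    linarith

lemma rpow_mul_norm_sum_zpow_sub_zpow_le {q : ℝ} (hq0 : 0 < q) (hq1 : q < 1) {β : ℂ}
    (hβ : ‖β‖ = 1) {s : ℝ} (hs : 0 < s) {l₁ : ℤ} (hl₁ : 0 < l₁) (i : ℕ) :
    q ^ ((1 + 2 * s) * ((l₁ : ℝ) + (i : ℝ))) * ‖∑ l ∈ Finset.Icc l₁ (l₁ + (i : ℤ)),
        ((β * qc q (1 / 2 - 2 * s)) ^ l - (β * qc q (1 / 2)) ^ l)‖ ≤
      2 * s * -Real.log q * (((i : ℝ) + 1) * (l₁ + i) * q ^ i) := by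
  have hl₁' : (0 : ℝ) < l₁ := by exact_mod_cast hl₁
  have hlog : 0 < -Real.log q := neg_pos.2 (Real.log_neg hq0 hq1)
  calc _ ≤ ∑ l ∈ Finset.Icc l₁ (l₁ + (i : ℤ)), q ^ ((1 + 2 * s) * ((l₁ : ℝ) + (i : ℝ))) *
          ‖(β * qc q (1 / 2 - 2 * s)) ^ l - (β * qc q (1 / 2)) ^ l‖ := by
        rw [← Finset.mul_sum]
        exact mul_le_mul_of_nonneg_left (norm_sum_le _ _) (Real.rpow_nonneg hq0.le _)
    _ ≤ ∑ l ∈ Finset.Icc l₁ (l₁ + (i : ℤ)),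
          q ^ ((l₁ : ℝ) + i) * (2 * s * (l₁ + i) * -Real.log q) := by
        refine Finset.sum_le_sum fun l hl => ?_
        rw [Finset.mem_Icc] at hl
        have := rpow_mul_norm_zpow_sub_zpow_le hq0 hq1 hβ hs (hl₁.trans_le hl.1) hl.2
        push_cast at this
        exact this
    _ = ((i : ℝ) + 1) * (q ^ ((l₁ : ℝ) + i) * (2 * s * (l₁ + i) * -Real.log q)) := by
        rw [Finset.sum_const, Int.card_Icc, nsmul_eq_mul,
          show (l₁ + (i : ℤ) + 1 - l₁).toNat = i + 1 by lia]
        push_cast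
        ring
    _ ≤ ((i : ℝ) + 1) * (q ^ i * (2 * s * (l₁ + i) * -Real.log q)) := by
        gcongr
        rw [← Real.rpow_natCast]
        exact Real.rpow_le_rpow_of_exponent_ge hq0 hq1.le (by linarith)
    _ = _ := by ring

lemma summable_quadratic_mul_geometric {q : ℝ} (hq0 : 0 < q) (hq1 : q < 1) (a : ℝ) :
    Summable fun i : ℕ => ((i : ℝ) + 1) * (a + i) * q ^ i := by
  have hq : ‖q‖ < 1 := by rwa [Real.norm_of_nonneg hq0.le]
  have h := fun k => summable_pow_mul_geometric_of_norm_lt_one k hq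
  refine (((h 2).add ((h 1).mul_left (a + 1))).add ((h 0).mul_left a)).congr fun i => ?_
  ring

lemma mul_inv_one_sub_rpow_le {q : ℝ} (hq0 : 0 < q) (hq1 : q < 1) {s : ℝ} (hs : 0 < s) :
    s * (1 - q ^ s)⁻¹ ≤ s + (-Real.log q)⁻¹ := by
  have hlog : 0 < -Real.log q := neg_pos.2 (Real.log_neg hq0 hq1)
  have hlt : q ^ s < 1 := Real.rpow_lt_one hq0.le hq1 hs
  have hexp := Real.add_one_le_exp (-(Real.log q * s))
  rw [Real.exp_neg, ← Real.rpow_def_of_pos hq0] at hexp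
  have hpos : 0 < q ^ s := Real.rpow_pos_of_pos hq0 s
  have hmul : (-(Real.log q * s) + 1) * q ^ s ≤ 1 := by
    rwa [← le_div_iff₀ hpos, one_div]
  rw [← div_eq_mul_inv, div_le_iff₀ (sub_pos.2 hlt)]
  have hinv : (-Real.log q)⁻¹ * -Real.log q = 1 := inv_mul_cancel₀ hlog.ne'
  refine le_of_mul_le_mul_right ?_ hlog
  have hexpand : (s + (-Real.log q)⁻¹) * (1 - q ^ s) * -Real.log q =
      (s * -Real.log q + (-Real.log q)⁻¹ * -Real.log q) * (1 - q ^ s) := by ring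
  rw [hexpand, hinv]
  linarith

/-- the final component of claim (3), with `l₁ ≤ l ≤ n` and `n = l₁ + i`. -/
theorem stmt13 (q : ℝ) (hq0 : 0 < q) (hq1 : q < 1) (c α : ℂ)
    (hc : ‖c‖ = 1) (hα : ‖α‖ = 1) (l₁ : ℤ) (hl₁ : 0 < l₁)
    (d : ℕ → ℂ) (hd : IsAdmissibleSeq q c l₁ d) (k₁ : ℂ)
    (T : ℝ → ℕ × ℕ → ℂ)
    (hT : ∀ (s : ℝ) (m i : ℕ),
      T s (m, i) = c ^ (2 * (l₁ + (i : ℤ)) + (m : ℤ)) *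
        qc q ((1 + 2 * s) * ((l₁ : ℝ) + (i : ℝ)) + (s - 1 / 2) * (m : ℝ)) * d m * k₁ *
        ∑ l ∈ Finset.Icc l₁ (l₁ + (i : ℤ)),
          ((c⁻¹ * α⁻¹ * qc q (1 / 2 - 2 * s)) ^ l - (c⁻¹ * α⁻¹ * qc q (1 / 2)) ^ l)) :
    (∀ s : ℝ, 0 < s → Summable fun p : ℕ × ℕ => ‖T s p‖) ∧
    Tendsto (fun s : ℝ => (s : ℂ) * ∑' p : ℕ × ℕ, T s p)
      (𝓝[>] (0 : ℝ)) (𝓝 0) := by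
  obtain ⟨C, hC, hdC⟩ := hd.exists_norm_le hq0 hc
  set w : ℕ → ℝ := fun i => ((i : ℝ) + 1) * (l₁ + i) * q ^ i
  have hws : Summable w := summable_quadratic_mul_geometric hq0 hq1 _
  have hl₁' : (0 : ℝ) < l₁ := by exact_mod_cast hl₁
  have hlog : 0 < -Real.log q := neg_pos.2 (Real.log_neg hq0 hq1)
  have hw0 : ∀ i, 0 ≤ w i := fun i => by positivity
  have hβ : ‖c⁻¹ * α⁻¹‖ = 1 := by simp [hc, hα]
  set K : ℝ := C * ‖k₁‖ * (2 * -Real.log q) with hK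
  have hK0 : 0 ≤ K := by positivity
  have hbound : ∀ s : ℝ, 0 < s → ∀ p : ℕ × ℕ,
      ‖T s p‖ ≤ s * K * ((q ^ s) ^ p.1 * w p.2) := by
    rintro s hs ⟨m, i⟩
    have hS := rpow_mul_norm_sum_zpow_sub_zpow_le hq0 hq1 hβ hs hl₁ i
    have hsplit : q ^ ((1 + 2 * s) * ((l₁ : ℝ) + i) + (s - 1 / 2) * m) * q ^ ((m : ℝ) / 2) =
        (q ^ s) ^ m * q ^ ((1 + 2 * s) * ((l₁ : ℝ) + i)) := by
      rw [← Real.rpow_natCast (q ^ s), ← Real.rpow_mul hq0.le, ← Real.rpow_add hq0,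
        ← Real.rpow_add hq0]
      ring_nf
    rw [hT, norm_mul, norm_mul, norm_mul, norm_mul, norm_zpow, hc, one_zpow, one_mul,
      norm_qc hq0]
    set S := ‖∑ l ∈ Finset.Icc l₁ (l₁ + (i : ℤ)),
      ((c⁻¹ * α⁻¹ * qc q (1 / 2 - 2 * s)) ^ l - (c⁻¹ * α⁻¹ * qc q (1 / 2)) ^ l)‖
    calc _ ≤ q ^ ((1 + 2 * s) * ((l₁ : ℝ) + i) + (s - 1 / 2) * m) *
            (C * q ^ ((m : ℝ) / 2)) * ‖k₁‖ * S := by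
          gcongr
          exact hdC m
      _ = C * ‖k₁‖ * (q ^ s) ^ m * (q ^ ((1 + 2 * s) * ((l₁ : ℝ) + i)) * S) := by
          linear_combination C * ‖k₁‖ * S * hsplit
      _ ≤ C * ‖k₁‖ * (q ^ s) ^ m * (2 * s * -Real.log q * w i) := by gcongr
      _ = _ := by rw [hK]; ring
  have hgeom : ∀ s : ℝ, 0 < s → HasSum (fun m : ℕ => (q ^ s) ^ m) (1 - q ^ s)⁻¹ := fun s hs =>
    hasSum_geometric_of_lt_one (Real.rpow_nonneg hq0.le s) (Real.rpow_lt_one hq0.le hq1 hs)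
  have hmaj : ∀ s : ℝ, 0 < s → HasSum (fun p : ℕ × ℕ => s * K * ((q ^ s) ^ p.1 * w p.2))
      (s * K * ((1 - q ^ s)⁻¹ * ∑' i, w i)) := fun s hs =>
    ((hgeom s hs).mul hws.hasSum <| (hgeom s hs).summable.mul_of_nonneg hws
      (fun m => by positivity) hw0).mul_left _
  refine ⟨fun s hs => Summable.of_nonneg_of_le (fun _ => norm_nonneg _) (hbound s hs)
    (hmaj s hs).summable, ?_⟩
  refine squeeze_zero_norm' (a := fun s : ℝ => s * ((s + (-Real.log q)⁻¹) * K * ∑' i, w i)) ?_ ?_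
  · filter_upwards [self_mem_nhdsWithin] with s hs
    rw [Set.mem_Ioi] at hs
    have hW : 0 ≤ ∑' i, w i := tsum_nonneg hw0
    have hsum := tsum_of_norm_bounded (hmaj s hs) (hbound s hs)
    rw [norm_mul, Complex.norm_real, Real.norm_of_nonneg hs.le]
    refine mul_le_mul_of_nonneg_left (hsum.trans ?_) hs.le
    calc _ = s * (1 - q ^ s)⁻¹ * K * ∑' i, w i := by ring
      _ ≤ _ := by
        gcongr
        exact mul_inv_one_sub_rpow_le hq0 hq1 hs
  · have hcont : Continuous fun s : ℝ => s * ((s + (-Real.log q)⁻¹) * K * ∑' i, w i) := by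
      fun_prop
    have h := hcont.tendsto 0
    rw [zero_mul] at h
    exact h.mono_left nhdsWithin_le_nhds
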